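/- Let ≺ be a bounded semiorder on a set X and let u : X → ℝ be an SS-representation of ≺. For every gap G of u(X), if some gap of u(X) has length strictly smaller than the length of G, then there exists a gap G' of u(X) with length(G') < length(G) such that no gap of u(X) has length strictly between length(G') and length(G). -/

import Mathlib

/-- A semiorder: an asymmetric relation satisfying the two semiorder axioms. -/
def IsSemiorder {X : Type*} (r : X → X → Prop) : Prop :=
  (∀ x y, r x y → ¬ r y x) ∧
  (∀ x y z t, r x y → r z t → r x t ∨ r z y) ∧
  (∀ x y z w, r x y → r y z → r x w ∨ r w z)

/-- A semiorder is bounded if it admits no strictly increasing and no strictly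
decreasing infinite sequence. -/
def BoundedSemiorder {X : Type*} (r : X → X → Prop) : Prop :=
  IsSemiorder r ∧ (¬ ∃ x : ℕ → X, ∀ n, r (x n) (x (n + 1))) ∧
    (¬ ∃ x : ℕ → X, ∀ n, r (x (n + 1)) (x n))

/-- A lacuna of `S ⊆ ℝ`: a nondegenerate interval disjoint from `S` having a
lower bound in `S` and an upper bound in `S`. -/
def IsLacuna (S G : Set ℝ) : Prop :=
  G.OrdConnected ∧ G.Nontrivial ∧ Disjoint G S ∧
    (∃ s ∈ S, ∀ x ∈ G, s ≤ x) ∧ (∃ s ∈ S, ∀ x ∈ G, x ≤ s)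

/-- A gap of `S ⊆ ℝ`: a maximal lacuna of `S`. -/
def IsGap (S G : Set ℝ) : Prop :=
  IsLacuna S G ∧ ∀ G', IsLacuna S G' → G ⊆ G' → G' = G

/-- The length of a gap: its supremum minus its infimum. -/
noncomputable def gapLength (G : Set ℝ) : ℝ := sSup G - sInf G

/-- The union of two overlapping lacunae is a lacuna. -/
theorem IsLacuna.union {S G H : Set ℝ} (hG : IsLacuna S G) (hH : IsLacuna S H)
    (h : (G ∩ H).Nonempty) : IsLacuna S (G ∪ H) := by
  obtain ⟨hGc, hGn, hGd, ⟨a, ha, ha'⟩, ⟨b, hb, hb'⟩⟩ := hG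
  obtain ⟨hHc, -, hHd, ⟨c, hc, hc'⟩, ⟨d, hd, hd'⟩⟩ := hH
  refine ⟨?_, hGn.mono Set.subset_union_left, Set.disjoint_union_left.2 ⟨hGd, hHd⟩, ?_, ?_⟩
  · rw [← isPreconnected_iff_ordConnected] at hGc hHc ⊢
    exact hGc.union' h hHc
  · rcases le_total a c with hac | hac
    · exact ⟨a, ha, fun x hx => hx.elim (ha' x) fun hx => hac.trans (hc' x hx)⟩
    · exact ⟨c, hc, fun x hx => hx.elim (fun hx => hac.trans (ha' x hx)) (hc' x)⟩
  · rcases le_total b d with hbd | hbd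
    · exact ⟨d, hd, fun x hx => hx.elim (fun hx => (hb' x hx).trans hbd) (hd' x)⟩
    · exact ⟨b, hb, fun x hx => hx.elim (hb' x) fun hx => (hd' x hx).trans hbd⟩

theorem IsGap.eq_of_inter_nonempty {S G H : Set ℝ} (hG : IsGap S G) (hH : IsGap S H)
    (h : (G ∩ H).Nonempty) : G = H :=
  (hG.2 _ (hG.1.union hH.1 h) Set.subset_union_left).symm.trans
    (hH.2 _ (hG.1.union hH.1 h) Set.subset_union_right)

theorem IsLacuna.bddBelow {S G : Set ℝ} (hG : IsLacuna S G) : BddBelow G := by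
  obtain ⟨-, -, -, ⟨a, -, ha⟩, -⟩ := hG
  exact ⟨a, ha⟩

theorem IsLacuna.bddAbove {S G : Set ℝ} (hG : IsLacuna S G) : BddAbove G := by
  obtain ⟨-, -, -, -, ⟨a, -, ha⟩⟩ := hG
  exact ⟨a, ha⟩

theorem IsLacuna.gapLength_pos {S G : Set ℝ} (hG : IsLacuna S G) : 0 < gapLength G := by
  obtain ⟨x, hx, y, hy, hxy⟩ := hG.2.1.exists_lt
  have h₁ := csInf_le hG.bddBelow hx
  have h₂ := le_csSup hG.bddAbove hy
  unfold gapLength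
  linarith

theorem IsLacuna.mem_of_sInf_lt_of_lt_sSup {S G : Set ℝ} (hG : IsLacuna S G) {x : ℝ}
    (h₁ : sInf G < x) (h₂ : x < sSup G) : x ∈ G := by
  obtain ⟨y, hy, hyx⟩ := exists_lt_of_csInf_lt hG.2.1.nonempty h₁
  obtain ⟨z, hz, hxz⟩ := exists_lt_of_lt_csSup hG.2.1.nonempty h₂
  exact hG.1.out hy hz ⟨hyx.le, hxz.le⟩

/-- A lacuna of length more than `ε` contains an integer multiple of `ε`. -/
theorem IsLacuna.exists_int_mul_mem {S G : Set ℝ} (hG : IsLacuna S G) {ε : ℝ} (hε : 0 < ε)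
    (h : ε < gapLength G) : ∃ k : ℤ, k * ε ∈ G := by
  unfold gapLength at h
  refine ⟨⌊sInf G / ε⌋ + 1, hG.mem_of_sInf_lt_of_lt_sSup ?_ ?_⟩ <;> push_cast
  · exact (div_lt_iff₀ hε).1 (Int.lt_floor_add_one _)
  · have := (le_div_iff₀ hε).1 (Int.floor_le (sInf G / ε))
    linarith

/-- A bounded set has only finitely many gaps of length more than a given positive number. -/
theorem finite_setOf_isGap_lt_gapLength {S : Set ℝ} (hb : BddBelow S) (ha : BddAbove S)
    {ε : ℝ} (hε : 0 < ε) : {G | IsGap S G ∧ ε < gapLength G}.Finite := by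
  obtain ⟨a, ha'⟩ := hb
  obtain ⟨b, hb'⟩ := ha
  choose! k hk using fun (G : Set ℝ) (hG : IsGap S G ∧ ε < gapLength G) =>
    hG.1.1.exists_int_mul_mem hε hG.2
  refine Set.Finite.of_finite_image ((Set.finite_Icc ⌊a / ε⌋ ⌈b / ε⌉).subset ?_) (f := k) ?_
  · rintro _ ⟨G, hG, rfl⟩
    obtain ⟨-, -, -, ⟨c, hc, hc'⟩, ⟨d, hd, hd'⟩⟩ := hG.1.1
    constructor
    · exact_mod_cast (Int.floor_le _).trans
        ((div_le_iff₀ hε).2 ((ha' hc).trans (hc' _ (hk G hG))))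
    · exact_mod_cast ((le_div_iff₀ hε).2 ((hd' _ (hk G hG)).trans (hb' hd))).trans
        (Int.le_ceil _)
  · intro G hG H hH h
    refine hG.1.eq_of_inter_nonempty hH.1 ⟨k G * ε, hk G hG, ?_⟩
    rw [h]
    exact hk H hH

theorem exists_seq_of_forall_exists {X : Type*} [Nonempty X] {r : X → X → Prop}
    (h : ∀ x, ∃ y, r x y) : ∃ x : ℕ → X, ∀ n, r (x n) (x (n + 1)) := by
  choose f hf using h
  refine ⟨fun n => f^[n] (Classical.arbitrary X), fun n => ?_⟩
  simp only [Function.iterate_succ_apply']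
  exact hf _

/-- An SS-representation of a bounded semiorder is bounded above. -/
theorem BoundedSemiorder.bddAbove_range {X : Type*} [Nonempty X] {r : X → X → Prop}
    (hr : BoundedSemiorder r) {u : X → ℝ} (hrep : ∀ x y, r x y ↔ u x + 1 < u y) :
    BddAbove (Set.range u) := by
  by_contra h
  refine hr.2.1 (exists_seq_of_forall_exists fun x => ?_)
  obtain ⟨_, ⟨y, rfl⟩, hy⟩ := not_bddAbove_iff.1 h (u x + 1)
  exact ⟨y, (hrep x y).2 hy⟩

/-- An SS-representation of a bounded semiorder is bounded below. -/
theorem BoundedSemiorder.bddBelow_range {X : Type*} [Nonempty X] {r : X → X → Prop}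
    (hr : BoundedSemiorder r) {u : X → ℝ} (hrep : ∀ x y, r x y ↔ u x + 1 < u y) :
    BddBelow (Set.range u) := by
  by_contra h
  refine hr.2.2 (exists_seq_of_forall_exists (r := fun x y => r y x) fun x => ?_)
  obtain ⟨_, ⟨y, rfl⟩, hy⟩ := not_bddBelow_iff.1 h (u x - 1)
  exact ⟨y, (hrep y x).2 (by linarith)⟩

/-- For an SS-representation of a bounded semiorder: below any gap having some
strictly smaller gap, there is a next smaller gap. -/
theorem next_smaller_gap {X : Type*}
    (r : X → X → Prop) (hr : BoundedSemiorder r)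
    (u : X → ℝ) (hrep : ∀ x y, r x y ↔ u x + 1 < u y) :
    ∀ G : Set ℝ, IsGap (Set.range u) G →
      (∃ G₀, IsGap (Set.range u) G₀ ∧ gapLength G₀ < gapLength G) →
      ∃ G' : Set ℝ, IsGap (Set.range u) G' ∧ gapLength G' < gapLength G ∧
        ¬ ∃ G'', IsGap (Set.range u) G'' ∧
          gapLength G' < gapLength G'' ∧ gapLength G'' < gapLength G := by
  rintro G hG ⟨G₀, hG₀, hlt⟩
  have : Nonempty X := (Set.range_nonempty_iff_nonempty (f := u)).1
    (hG.1.2.2.2.1.imp fun _ h => h.1)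
  have hpos := hG₀.1.gapLength_pos
  have hfin := (finite_setOf_isGap_lt_gapLength (hr.bddBelow_range hrep)
    (hr.bddAbove_range hrep) (half_pos hpos)).subset
      (Set.sep_subset _ fun H => gapLength H < gapLength G)
  obtain ⟨G', ⟨⟨hG', hhalf⟩, hG'lt⟩, hmax⟩ :=
    Set.exists_max_image _ gapLength hfin ⟨G₀, ⟨hG₀, half_lt_self hpos⟩, hlt⟩
  refine ⟨G', hG', hG'lt, ?_⟩
  rintro ⟨G'', hG'', h₁, h₂⟩
  exact h₁.not_ge (hmax G'' ⟨⟨hG'', hhalf.trans h₁⟩, h₂⟩)
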